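/- Let A ∈ ℝ^{n×n}, B ∈ ℝ^{n×m}, K ∈ ℝ^{m×n}, and let φ : ℝᵐ → ℝᵐ be the saturation function defined componentwise by φᵢ(u) = sign(uᵢ)·min{|uᵢ|, 1}. Define f(e, v) = Ae + B(φ(Ke + v) − v). For every e ∈ ℝⁿ and every v ∈ ℝᵐ with ‖v‖_∞ ≤ 1, the vector f(e, v) lies in the convex hull of the finite set { (A + Σ_{i∈J} B₍ᵢ₎ Kᵢ) e : J ⊆ {1,…,m} }, where B₍ᵢ₎ is the i-th column of B and Kᵢ is the i-th row of K. -/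

import Mathlib

open Matrix

/-- Componentwise saturation function: φᵢ(u) = sign(uᵢ)·min{|uᵢ|, 1}. -/
noncomputable def sat {m : ℕ} (u : Fin m → ℝ) : Fin m → ℝ :=
  fun i => Real.sign (u i) * min |u i| 1

/-- Saturated error map: f(e, v) = A e + B (φ(K e + v) − v). -/
noncomputable def fSat {n m : ℕ} (A : Matrix (Fin n) (Fin n) ℝ)
    (B : Matrix (Fin n) (Fin m) ℝ) (K : Matrix (Fin m) (Fin n) ℝ)
    (e : Fin n → ℝ) (v : Fin m → ℝ) : Fin n → ℝ :=
  A.mulVec e + B.mulVec (sat (K.mulVec e + v) - v)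

/-- M_J = A + Σ_{i∈J} B₍ᵢ₎ Kᵢ, where B₍ᵢ₎ is the i-th column of B and Kᵢ the i-th row of K. -/
noncomputable def MJ {n m : ℕ} (A : Matrix (Fin n) (Fin n) ℝ)
    (B : Matrix (Fin n) (Fin m) ℝ) (K : Matrix (Fin m) (Fin n) ℝ)
    (J : Finset (Fin m)) : Matrix (Fin n) (Fin n) ℝ :=
  A + ∑ i ∈ J, Matrix.vecMulVec (fun r => B r i) (K i)

/-- A convex set containing all the vertices `a + ∑ i ∈ J, w i` with `J ⊆ S` contains the zonotope
they span. -/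
theorem Convex.add_sum_smul_mem {ι E : Type*} [AddCommGroup E] [Module ℝ E] {C : Set E}
    (hC : Convex ℝ C) {c : ι → ℝ} (hc : ∀ i, c i ∈ Set.Icc (0 : ℝ) 1) (w : ι → E) (S : Finset ι)
    (a : E) (h : ∀ J ⊆ S, a + ∑ i ∈ J, w i ∈ C) : a + ∑ i ∈ S, c i • w i ∈ C := by
  classical
  induction S using Finset.induction_on generalizing a with
  | empty => simpa using h ∅ subset_rfl
  | insert i S hi ih =>
    have h₀ := ih a fun J hJ => h J (hJ.trans (Finset.subset_insert i S))
    have h₁ := ih (a + w i) fun J hJ => by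
      have := h (insert i J) (Finset.insert_subset_insert i hJ)
      rwa [Finset.sum_insert fun hiJ => hi (hJ hiJ), ← add_assoc] at this
    have := hC h₀ h₁ (sub_nonneg.2 (hc i).2) (hc i).1 (sub_add_cancel _ _)
    rw [Finset.sum_insert hi]
    convert this using 1
    module

theorem Real.sign_mul_min_abs_one (x : ℝ) : Real.sign x * min |x| 1 = max (-1) (min x 1) := by
  rcases lt_trichotomy x 0 with hx | rfl | hx
  · rw [Real.sign_of_neg hx, abs_of_neg hx, min_eq_left (by linarith : x ≤ 1), neg_one_mul,
      ← max_neg_neg, neg_neg, max_comm]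
  · simp
  · rw [Real.sign_of_pos hx, abs_of_pos hx, one_mul, max_eq_right]
    exact le_min (by linarith) (by norm_num)

/-- Saturating `k + v`, where `v` is itself unsaturated, moves `v` by a fraction of `k`. -/
theorem exists_sign_mul_min_abs_sub_eq_mul {v : ℝ} (k : ℝ) (hv : |v| ≤ 1) :
    ∃ c ∈ Set.Icc (0 : ℝ) 1, Real.sign (k + v) * min |k + v| 1 - v = c * k := by
  obtain ⟨hv₁, hv₂⟩ := abs_le.1 hv
  rw [Real.sign_mul_min_abs_one]
  by_cases h₁ : 1 < k + v
  · have hk : 0 < k := by linarith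
    refine ⟨(1 - v) / k, ⟨div_nonneg (by linarith) hk.le, (div_le_one hk).2 (by linarith)⟩, ?_⟩
    rw [min_eq_right h₁.le, max_eq_right (by norm_num), div_mul_cancel₀ _ hk.ne']
  by_cases h₂ : k + v < -1
  · have hk : k < 0 := by linarith
    refine ⟨(-1 - v) / k, ⟨div_nonneg_of_nonpos (by linarith) hk.le,
      (div_le_one_of_neg hk).2 (by linarith)⟩, ?_⟩
    rw [min_eq_left (by linarith), max_eq_left h₂.le, div_mul_cancel₀ _ hk.ne]
  · refine ⟨1, by simp, ?_⟩
    rw [min_eq_left (by linarith), max_eq_right (by linarith)]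
    ring

theorem MJ_mulVec {n m : ℕ} (A : Matrix (Fin n) (Fin n) ℝ) (B : Matrix (Fin n) (Fin m) ℝ)
    (K : Matrix (Fin m) (Fin n) ℝ) (J : Finset (Fin m)) (e : Fin n → ℝ) :
    (MJ A B K J).mulVec e = A.mulVec e + ∑ i ∈ J, K.mulVec e i • B.col i := by
  rw [MJ, Matrix.add_mulVec, Matrix.sum_mulVec]
  congr 1
  refine Finset.sum_congr rfl fun i _ => ?_
  rw [Matrix.vecMulVec_mulVec, op_smul_eq_smul]
  rfl

theorem fSat_mem_convexHull {n m : ℕ} (A : Matrix (Fin n) (Fin n) ℝ)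
    (B : Matrix (Fin n) (Fin m) ℝ) (K : Matrix (Fin m) (Fin n) ℝ)
    (e : Fin n → ℝ) (v : Fin m → ℝ) (hv : ∀ i, |v i| ≤ 1) :
    fSat A B K e v ∈
      convexHull ℝ (Set.range fun J : Finset (Fin m) => (MJ A B K J).mulVec e) := by
  choose c hc hcv using fun i => exists_sign_mul_min_abs_sub_eq_mul (K.mulVec e i) (hv i)
  have hf : fSat A B K e v =
      A.mulVec e + ∑ i, c i • K.mulVec e i • B.col i := by
    have hs : sat (K.mulVec e + v) - v = fun i => c i * K.mulVec e i := funext hcv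
    rw [fSat, hs, Matrix.mulVec_eq_sum _ B]
    simp only [op_smul_eq_smul, mul_smul]
    rfl
  rw [hf]
  refine (convex_convexHull ℝ _).add_sum_smul_mem hc _ _ _ fun J _ => subset_convexHull ℝ _ ?_
  exact ⟨J, MJ_mulVec A B K J e⟩
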